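/- arXiv:0808.1463 — 2 statements merged into one kernel-verified Lean document; each statement's English description precedes it below -/
import Mathlib

section
/- Let $S \subseteq R$ be a subset and $n : \Psi \to \mathbb{N}$ be such that $\sum_{\alpha \in S} \alpha = \sum_{\beta \in \Psi} n_\beta \beta$ and $|S| \le \sum_{\beta \in \Psi} n_\beta$. Then $S \subseteq \Psi$, $\sum_{\beta \in \Psi} n_\beta = |S|$, and consequently $\sum_{\beta \in \Psi} n_\beta \le |\Psi|$. (This is the combinatorial step showing that $\operatorname{Ext}^j$ between simples vanishes for $j > |\Psi|$: a weight of $\wedge^j \mathfrak{g}$ is a sum of at most $j$ distinct roots.) -/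
open scoped RealInnerProductSpace

/-- Let `E` be a real inner product space, `R ⊆ E` a finite subset, `ξ ∈ E` with
`M = max_{α ∈ R} ⟪α, ξ⟫ > 0`, and `Ψ = {α ∈ R : ⟪α, ξ⟫ = M}`.  If `S ⊆ R` and
`n : Ψ → ℕ` satisfy `∑_{α ∈ S} α = ∑_{β ∈ Ψ} n β • β` and `|S| ≤ ∑_{β ∈ Ψ} n β`,
then `S ⊆ Ψ`, `∑_{β ∈ Ψ} n β = |S|`, and consequently `∑_{β ∈ Ψ} n β ≤ |Ψ|`. -/
theorem subset_psi_of_sum_eq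
    {E : Type*} [NormedAddCommGroup E] [InnerProductSpace ℝ E]
    (R Ψ : Finset E) (ξ : E) (M : ℝ) (hMpos : 0 < M)
    (hMub : ∀ α ∈ R, ⟪α, ξ⟫ ≤ M) (hMmem : ∃ α ∈ R, ⟪α, ξ⟫ = M)
    (hΨ : ∀ α : E, α ∈ Ψ ↔ α ∈ R ∧ ⟪α, ξ⟫ = M)
    (S : Finset E) (hS : S ⊆ R) (n : E → ℕ)
    (h : ∑ α ∈ S, α = ∑ β ∈ Ψ, n β • β)
    (hcard : S.card ≤ ∑ β ∈ Ψ, n β) :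
    S ⊆ Ψ ∧ ∑ β ∈ Ψ, n β = S.card ∧ ∑ β ∈ Ψ, n β ≤ Ψ.card := by
  have hsum : ∑ α ∈ S, ⟪α, ξ⟫ = ((∑ β ∈ Ψ, n β : ℕ) : ℝ) * M := by
    rw [← sum_inner, h, sum_inner, Nat.cast_sum, Finset.sum_mul]
    refine Finset.sum_congr rfl fun β hβ => ?_
    rw [← Nat.cast_smul_eq_nsmul ℝ, real_inner_smul_left, ((hΨ β).1 hβ).2]
  have hle : ∑ α ∈ S, ⟪α, ξ⟫ ≤ S.card * M := by
    simpa using Finset.sum_le_sum fun α hα => hMub α (hS hα)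
  have heq : ∑ β ∈ Ψ, n β = S.card := by
    refine le_antisymm ?_ hcard
    rw [hsum] at hle
    exact_mod_cast le_of_mul_le_mul_right hle hMpos
  have hsub : S ⊆ Ψ := by
    have hall := (Finset.sum_eq_sum_iff_of_le fun α hα => hMub α (hS hα)).1
      (show ∑ α ∈ S, ⟪α, ξ⟫ = ∑ _α ∈ S, M by rw [hsum, heq]; simp)
    exact fun α hα => (hΨ α).2 ⟨hS hα, hall α hα⟩
  exact ⟨hsub, heq, heq.trans_le (Finset.card_le_card hsub)⟩
end

section
/- Let $\lambda_\Psi = \sum_{\beta \in \Psi} \beta$. If $S \subseteq R$ is a subset with $|S| \le |\Psi|$ and $\sum_{\alpha \in S} \alpha = \lambda_\Psi$, then $S = \Psi$. (This is the combinatorial core of the fact that the $\lambda_\Psi$-weight space of $\wedge^{|\Psi|}\mathfrak{g}$ is one-dimensional, spanned by $\wedge_{\beta \in \Psi} x^+_\beta$.) -/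
open scoped RealInnerProductSpace

/-- Let `E` be a real inner product space, `R ⊆ E` a finite subset, `ξ ∈ E` with
`M = max_{α ∈ R} ⟪α, ξ⟫ > 0`, and `Ψ = {α ∈ R : ⟪α, ξ⟫ = M}`.  Let
`λ_Ψ = ∑_{β ∈ Ψ} β`.  If `S ⊆ R` with `|S| ≤ |Ψ|` and `∑_{α ∈ S} α = λ_Ψ`,
then `S = Ψ`. -/
theorem eq_psi_of_sum_eq_lambdaPsi
    {E : Type*} [NormedAddCommGroup E] [InnerProductSpace ℝ E]
    (R Ψ : Finset E) (ξ : E) (M : ℝ) (hMpos : 0 < M)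
    (hMub : ∀ α ∈ R, ⟪α, ξ⟫ ≤ M) (hMmem : ∃ α ∈ R, ⟪α, ξ⟫ = M)
    (hΨ : ∀ α : E, α ∈ Ψ ↔ α ∈ R ∧ ⟪α, ξ⟫ = M)
    (S : Finset E) (hS : S ⊆ R) (hcard : S.card ≤ Ψ.card)
    (h : ∑ α ∈ S, α = ∑ β ∈ Ψ, β) :
    S = Ψ := by
  have hΨsum : ∑ β ∈ Ψ, ⟪β, ξ⟫ = Ψ.card * M := by
    rw [Finset.sum_congr rfl fun β hβ => ((hΨ β).1 hβ).2, Finset.sum_const, nsmul_eq_mul]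
  have hSsum : ∑ α ∈ S, ⟪α, ξ⟫ = Ψ.card * M := by
    rw [← sum_inner, h, sum_inner, hΨsum]
  have hgap : ∑ α ∈ S, (M - ⟪α, ξ⟫) = (S.card - Ψ.card : ℝ) * M := by
    rw [Finset.sum_sub_distrib, hSsum, Finset.sum_const, nsmul_eq_mul, sub_mul]
  have hgap_nonneg : ∀ α ∈ S, 0 ≤ M - ⟪α, ξ⟫ := fun α hα => sub_nonneg.2 (hMub α (hS hα))
  have hcard' : (S.card : ℝ) ≤ Ψ.card := by exact_mod_cast hcard
  have hgap_zero : ∑ α ∈ S, (M - ⟪α, ξ⟫) = 0 :=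
    le_antisymm (hgap ▸ mul_nonpos_of_nonpos_of_nonneg (sub_nonpos.2 hcard') hMpos.le)
      (Finset.sum_nonneg hgap_nonneg)
  have hsub : S ⊆ Ψ := fun α hα =>
    (hΨ α).2 ⟨hS hα,
      (sub_eq_zero.1 ((Finset.sum_eq_zero_iff_of_nonneg hgap_nonneg).1 hgap_zero α hα)).symm⟩
  have hcard_eq : (S.card : ℝ) = Ψ.card :=
    sub_eq_zero.1 ((mul_eq_zero.1 (hgap.symm.trans hgap_zero)).resolve_right hMpos.ne')
  exact Finset.eq_of_subset_of_card_le hsub (by exact_mod_cast hcard_eq.ge)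
end
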